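/- Let v > 0, λ > 0, and let θ be a nonzero real number. Then (1 + 1/(λ²θ²))^{−(v+1)/2} = ∫_{1/|θ|}^∞ ((v+1)·t/λ²)·(1 + t²/λ²)^{−(v+3)/2} dt. Equivalently, the reciprocalized Student-t kernel θ ↦ θ^{−2}·(1 + 1/(λ²θ²))^{−(v+1)/2} is a scale mixture of inverse uniform (double Pareto) kernels (1/(2tθ²))·1{|θ| > 1/t} with mixing weight proportional to t²·(1 + t²/λ²)^{−(v+3)/2}. -/

import Mathlib

open MeasureTheory Real Set

/-- The reciprocalized Student-t kernel is a scale mixture of inverse uniform (double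
Pareto) kernels: the defining integral identity. -/
theorem stmt_11 (v lam θ : ℝ) (hv : 0 < v) (hlam : 0 < lam) (hθ : θ ≠ 0) :
    (1 + 1 / (lam ^ 2 * θ ^ 2)) ^ (-(v + 1) / 2)
      = ∫ t in Ioi (1 / |θ|),
          ((v + 1) * t / lam ^ 2) * (1 + t ^ 2 / lam ^ 2) ^ (-(v + 3) / 2) := by
  have hpos : ∀ t : ℝ, 0 < 1 + t ^ 2 / lam ^ 2 := fun t => by positivity
  have hderiv : ∀ t ∈ Ici (1 / |θ|),
      HasDerivAt (fun t : ℝ => -(1 + t ^ 2 / lam ^ 2) ^ (-(v + 1) / 2))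
        (((v + 1) * t / lam ^ 2) * (1 + t ^ 2 / lam ^ 2) ^ (-(v + 3) / 2)) t := by
    intro t _
    have h1 : HasDerivAt (fun t : ℝ => 1 + t ^ 2 / lam ^ 2) (2 * t / lam ^ 2) t := by
      simpa using ((hasDerivAt_pow 2 t).div_const (lam ^ 2)).const_add 1
    have h2 := (h1.rpow_const (p := -(v + 1) / 2) (Or.inl (hpos t).ne')).neg
    refine HasDerivAt.congr_deriv h2 ?_
    rw [show -(v + 1) / 2 - 1 = -(v + 3) / 2 by ring]
    ring
  have hlim : Filter.Tendsto (fun t : ℝ => -(1 + t ^ 2 / lam ^ 2) ^ (-(v + 1) / 2))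
      Filter.atTop (nhds 0) := by
    have h1 : Filter.Tendsto (fun t : ℝ => 1 + t ^ 2 / lam ^ 2) Filter.atTop Filter.atTop :=
      Filter.tendsto_atTop_add_const_left _ _
        ((Filter.tendsto_pow_atTop two_ne_zero).atTop_div_const (by positivity))
    have h2 := ((tendsto_rpow_neg_atTop (y := (v + 1) / 2) (by positivity)).comp h1).neg
    rw [show -(v + 1) / 2 = -((v + 1) / 2) by ring]
    simpa only [Function.comp_def, neg_zero] using h2
  rw [integral_Ioi_of_hasDerivAt_of_nonneg' hderiv ?_ hlim]
  · have : (1 / |θ|) ^ 2 / lam ^ 2 = 1 / (lam ^ 2 * θ ^ 2) := by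
      rw [div_pow, sq_abs]
      field_simp
    rw [this]
    ring
  · intro t ht
    have : 0 < t := lt_trans (by positivity) ht
    have := hpos t
    positivity
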